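/- For every C > 0 and every ε > 0 there exists N such that for all n ≥ N and all integers k with |k − 2·log₂ n| ≤ C·log log n: (a) n^{−1−ε} ≤ E[Y_{k+1}]/E[Y_k] ≤ n^{−1+ε}, and (b) for every integer i with 1 ≤ i ≤ C·log log n one has k^{2i(1−ε)}·E[Y_k] ≤ E[Z_{k,i}] ≤ k^{2i(1+ε)}·E[Y_k]. -/

import Mathlib

/-- `E[Y_k] = C(n,k)·2^{-C(k,2)}`, the expected number of independent `k`-sets
in `G_{n,1/2}`. -/
noncomputable def expY (n k : ℕ) : ℝ := (n.choose k : ℝ) / 2 ^ (k.choose 2)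

/-- `E[Z_{k,i}] = C(n,k)·C(C(k,2),i)·2^{-C(k,2)}`, the expected number of `k`-sets
inducing exactly `i` edges in `G_{n,1/2}`. -/
noncomputable def expZ (n k i : ℕ) : ℝ :=
  (n.choose k : ℝ) * ((k.choose 2).choose i : ℝ) / 2 ^ (k.choose 2)

lemma expY_succ_div {n k : ℕ} (h : k < n) :
    expY n (k + 1) / expY n k = ((n : ℝ) - k) / ((k + 1) * 2 ^ k) := by
  have h1 : (n.choose (k + 1) : ℝ) * (k + 1) = n.choose k * ((n : ℝ) - k) := by
    rw [← Nat.cast_sub h.le]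
    exact_mod_cast Nat.choose_succ_right_eq n k
  have h2 : (k + 1).choose 2 = k + k.choose 2 := by
    rw [Nat.choose_succ_succ' k 1, Nat.choose_one_right]
  have h3 : (n.choose k : ℝ) ≠ 0 := by
    exact_mod_cast (Nat.choose_pos h.le).ne'
  have h4 : (k : ℝ) + 1 ≠ 0 := by positivity
  unfold expY
  rw [h2, pow_add]
  field_simp
  linarith

lemma expZ_eq (n k i : ℕ) : expZ n k i = ((k.choose 2).choose i : ℝ) * expY n k := by
  unfold expZ expY
  ring

lemma expY_nonneg (n k : ℕ) : 0 ≤ expY n k := by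
  unfold expY
  positivity

lemma half_div_pow_le_choose {m i : ℕ} (hi : 1 ≤ i) (h : 2 * i ≤ m) :
    ((m : ℝ) / (2 * i)) ^ i ≤ m.choose i := by
  have hi0 : (0 : ℝ) < i := by exact_mod_cast hi
  have h1 : ((m + 1 - i : ℕ) : ℝ) ^ i ≤ (i.factorial : ℝ) * m.choose i := by
    have := Nat.pow_sub_le_descFactorial m i
    rw [Nat.descFactorial_eq_factorial_mul_choose] at this
    exact_mod_cast this
  have h2 : (i.factorial : ℝ) ≤ (i : ℝ) ^ i := by exact_mod_cast Nat.factorial_le_pow i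
  have h3 : (m : ℝ) / 2 ≤ ((m + 1 - i : ℕ) : ℝ) := by
    have : m ≤ 2 * (m + 1 - i) := by omega
    have : (m : ℝ) ≤ 2 * ((m + 1 - i : ℕ) : ℝ) := by exact_mod_cast this
    linarith
  rw [← div_div, div_pow, div_le_iff₀ (by positivity)]
  calc ((m : ℝ) / 2) ^ i ≤ ((m + 1 - i : ℕ) : ℝ) ^ i := by gcongr
    _ ≤ (i.factorial : ℝ) * m.choose i := h1
    _ ≤ (i : ℝ) ^ i * m.choose i := by gcongr
    _ = _ := mul_comm _ _

lemma eventually_mul_log_le_rpow (c : ℝ) {p : ℝ} (hp : 0 < p) :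
    ∀ᶠ x : ℝ in Filter.atTop, c * Real.log x ≤ x ^ p := by
  have h := ((isLittleO_log_rpow_atTop hp).const_mul_left c).bound one_pos
  filter_upwards [h, Filter.eventually_ge_atTop 0] with x hx hx0
  rw [Real.norm_of_nonneg (Real.rpow_nonneg hx0 p), one_mul] at hx
  exact (le_abs_self _).trans hx

lemma choose_two_choose_le {k i : ℕ} (hk : 1 ≤ k) {ε : ℝ} (hε : 0 ≤ ε) :
    ((k.choose 2).choose i : ℝ) ≤ (k : ℝ) ^ (2 * (i : ℝ) * (1 + ε)) := by
  have hk1 : (1 : ℝ) ≤ k := by exact_mod_cast hk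
  calc ((k.choose 2).choose i : ℝ) ≤ (k : ℝ) ^ (2 * i) := by
        rw [pow_mul]
        exact_mod_cast (Nat.choose_le_pow _ _).trans
          (Nat.pow_le_pow_left (Nat.choose_le_pow k 2) i)
    _ = (k : ℝ) ^ (2 * (i : ℝ)) := by
        rw [← Real.rpow_natCast]
        push_cast
        rfl
    _ ≤ _ := by
        apply Real.rpow_le_rpow_of_exponent_le hk1
        have : (0 : ℝ) ≤ i := i.cast_nonneg
        nlinarith [mul_nonneg this hε]

lemma le_choose_two_choose {k i : ℕ} (hk : 2 ≤ k) (hi : 1 ≤ i) (hik : 8 * i ≤ k) {ε : ℝ}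
    (h : 8 * (i : ℝ) ≤ (k : ℝ) ^ (2 * ε)) :
    (k : ℝ) ^ (2 * (i : ℝ) * (1 - ε)) ≤ ((k.choose 2).choose i : ℝ) := by
  have hk2 : (2 : ℝ) ≤ k := by exact_mod_cast hk
  have hk0 : (0 : ℝ) < k := by linarith
  have hi0 : (0 : ℝ) < i := by exact_mod_cast hi
  have hik' : 8 * (i : ℝ) ≤ k := by exact_mod_cast hik
  have hm : (k : ℝ) ^ 2 / 4 ≤ (k.choose 2 : ℝ) := by
    rw [Nat.cast_choose_two]
    nlinarith
  have him : 2 * i ≤ k.choose 2 := by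
    have : 2 * (i : ℝ) ≤ (k.choose 2 : ℝ) := by nlinarith
    exact_mod_cast this
  refine le_trans ?_ (half_div_pow_le_choose hi him)
  have e : (k : ℝ) ^ (2 * (i : ℝ) * (1 - ε)) = ((k : ℝ) ^ 2 / (k : ℝ) ^ (2 * ε)) ^ i := by
    rw [← Real.rpow_natCast _ i, ← Real.rpow_two, ← Real.rpow_sub hk0, ← Real.rpow_mul hk0.le]
    ring_nf
  rw [e]
  refine pow_le_pow_left₀ (by positivity) ?_ i
  calc (k : ℝ) ^ 2 / (k : ℝ) ^ (2 * ε) ≤ (k : ℝ) ^ 2 / (8 * i) := by gcongr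
    _ = (k : ℝ) ^ 2 / 4 / (2 * i) := by
        field_simp
        norm_num
    _ ≤ _ := by gcongr

lemma expY_succ_div_bounds {n k : ℕ} {δ η : ℝ} (hn : 0 < n) (hk : 2 * k ≤ n)
    (hδ : |(k : ℝ) - 2 * Real.logb 2 n| ≤ δ)
    (hη : Real.log 2 + Real.log (k + 1) + δ ≤ η * Real.log n) :
    (n : ℝ) ^ (-1 - η) ≤ expY n (k + 1) / expY n k ∧
      expY n (k + 1) / expY n k ≤ (n : ℝ) ^ (-1 + η) := by
  have hn0 : (0 : ℝ) < n := by exact_mod_cast hn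
  have hk0 : (0 : ℝ) ≤ k := k.cast_nonneg
  have hkn : 2 * (k : ℝ) ≤ n := by exact_mod_cast hk
  have hpos : (0 : ℝ) < n - k := by linarith
  rw [expY_succ_div (by omega)]
  have hlog : Real.log (((n : ℝ) - k) / ((k + 1) * 2 ^ k)) =
      Real.log ((n : ℝ) - k) - Real.log (k + 1) - k * Real.log 2 := by
    rw [Real.log_div (by positivity) (by positivity), Real.log_mul (by positivity) (by positivity),
      Real.log_pow]
    ring
  have hq : 0 < ((n : ℝ) - k) / ((k + 1) * 2 ^ k) := div_pos hpos (by positivity)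
  have hup : Real.log ((n : ℝ) - k) ≤ Real.log n := Real.log_le_log hpos (by linarith)
  have hlo : Real.log n - Real.log 2 ≤ Real.log ((n : ℝ) - k) := by
    rw [← Real.log_div (by positivity) (by norm_num)]
    exact Real.log_le_log (by positivity) (by linarith)
  have hl2 : 0 < Real.log 2 := Real.log_pos one_lt_two
  have hl2' : Real.log 2 ≤ 1 := by linarith [Real.log_two_lt_d9]
  have hlk : 0 ≤ Real.log ((k : ℝ) + 1) := Real.log_nonneg (by linarith)
  have hb : Real.logb 2 n * Real.log 2 = Real.log n := by
    rw [Real.logb, div_mul_cancel₀ _ hl2.ne']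
  have hδ0 : 0 ≤ δ := (abs_nonneg _).trans hδ
  obtain ⟨h1, h2⟩ := abs_le.mp hδ
  have h3 : δ * Real.log 2 ≤ δ := mul_le_of_le_one_right hδ0 hl2'
  have h4 := mul_le_mul_of_nonneg_right h1 hl2.le
  have h5 := mul_le_mul_of_nonneg_right h2 hl2.le
  constructor
  · rw [← Real.log_le_log_iff (by positivity) hq, Real.log_rpow hn0, hlog]
    linarith
  · rw [← Real.log_le_log_iff hq (by positivity), Real.log_rpow hn0, hlog]
    linarith

theorem stmt5 (C ε : ℝ) (hC : 0 < C) (hε : 0 < ε) :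
    ∃ N : ℕ, ∀ n : ℕ, N ≤ n → ∀ k : ℕ,
      |(k : ℝ) - 2 * Real.logb 2 n| ≤ C * Real.log (Real.log n) →
      ((n : ℝ) ^ (-1 - ε) ≤ expY n (k + 1) / expY n k ∧
        expY n (k + 1) / expY n k ≤ (n : ℝ) ^ (-1 + ε)) ∧
      (∀ i : ℕ, 1 ≤ i → (i : ℝ) ≤ C * Real.log (Real.log n) →
        (k : ℝ) ^ (2 * (i : ℝ) * (1 - ε)) * expY n k ≤ expZ n k i ∧
          expZ n k i ≤ (k : ℝ) ^ (2 * (i : ℝ) * (1 + ε)) * expY n k) := by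
  have hL : Filter.Tendsto (fun n : ℕ => Real.log n) Filter.atTop Filter.atTop :=
    Real.tendsto_log_atTop.comp tendsto_natCast_atTop_atTop
  have hn := tendsto_natCast_atTop_atTop (R := ℝ) |>.eventually
    (eventually_mul_log_le_rpow 10 one_pos)
  obtain ⟨N, hN⟩ := Filter.eventually_atTop.mp
    ((hL.eventually (((Filter.eventually_ge_atTop 12).and (eventually_mul_log_le_rpow (8 * C) one_pos)).and
      ((eventually_mul_log_le_rpow (8 * C) (p := 2 * ε) (by positivity)).and
        (eventually_mul_log_le_rpow ((2 + C) / ε) one_pos)))).and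
       (hn.and (Filter.eventually_gt_atTop 0)))
  refine ⟨N, fun n hNn k hk => ?_⟩
  obtain ⟨⟨⟨h12, hCL⟩, hCε, hεL⟩, hnL, hn0⟩ := hN n hNn
  rw [Real.rpow_one] at hCL hεL hnL
  set L := Real.log n with hLdef
  have hl2 : 1 / 2 < Real.log 2 := by linarith [Real.log_two_gt_d9]
  have hl2' : Real.log 2 < 1 := by linarith [Real.log_two_lt_d9]
  have hb1 : L ≤ Real.logb 2 n := by
    rw [Real.logb, le_div_iff₀ (by linarith)]
    nlinarith
  have hb2 : Real.logb 2 n ≤ 2 * L := by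
    rw [Real.logb, div_le_iff₀ (by linarith)]
    nlinarith
  obtain ⟨h1, h2⟩ := abs_le.mp hk
  have hkL : L ≤ k := by linarith
  have hk5 : (k : ℝ) ≤ 5 * L := by linarith
  have hk12 : (12 : ℝ) ≤ k := h12.trans hkL
  have hk2 : 2 ≤ k := by
    have : 12 ≤ k := by exact_mod_cast hk12
    omega
  refine ⟨expY_succ_div_bounds hn0 ?_ hk ?_, fun i hi hiC => ?_⟩
  · have : 2 * (k : ℝ) ≤ n := by linarith
    exact_mod_cast this
  · rw [div_mul_eq_mul_div, div_le_iff₀ hε] at hεL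
    have : Real.log 2 + Real.log (k + 1) ≤ 2 * Real.log L := by
      rw [← Real.log_mul (by norm_num) (by positivity), two_mul (Real.log L),
        ← Real.log_mul (by positivity) (by positivity)]
      exact Real.log_le_log (by positivity) (by nlinarith)
    linarith
  · rw [expZ_eq]
    have hik : 8 * i ≤ k := by
      have : 8 * (i : ℝ) ≤ k := by linarith
      exact_mod_cast this
    have hiε : 8 * (i : ℝ) ≤ (k : ℝ) ^ (2 * ε) := by
      have : L ^ (2 * ε) ≤ (k : ℝ) ^ (2 * ε) := by gcongr
      linarith
    exact ⟨mul_le_mul_of_nonneg_right (le_choose_two_choose hk2 hi hik hiε) (expY_nonneg n k),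
      mul_le_mul_of_nonneg_right (choose_two_choose_le (by omega) hε.le) (expY_nonneg n k)⟩
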